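/- Let G be a graph with girth g and directed edge matrix A_e with eigenvalue multiset {η_i}. Then for every k with g ≤ k < 2g, the number of k-cycles in G equals (Σ_i η_i^k)/(2k). -/

import Mathlib

open SimpleGraph Matrix Polynomial

variable {V : Type*} [Fintype V] [DecidableEq V]

/-- The directed edge matrix of a graph. -/
def edgeMatrix (G : SimpleGraph V) [DecidableRel G.Adj] (R : Type*) [Zero R] [One R] :
    Matrix G.Dart G.Dart R :=
  fun e f => if e.snd = f.fst ∧ f ≠ e.symm then 1 else 0

/-- The number of `k`-cycles of `G`, i.e. cycle subgraphs with `k` edges,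
identified by their edge sets. -/
noncomputable def cycleCount (G : SimpleGraph V) (k : ℕ) : ℕ :=
  Nat.card {s : Finset (Sym2 V) // ∃ (v : V) (p : G.Walk v v),
    p.IsCycle ∧ p.length = k ∧ p.edges.toFinset = s}


section Algebra

theorem aux_det_prod {n : Type*} [Fintype n] [DecidableEq n] (A : Matrix n n ℂ) (s : Multiset ℂ) :
    (aeval A ((s.map fun r => (X - C r)).prod)).det =
      (A.charpoly.roots.map fun η => ((s.map fun r => (X - C r)).prod).eval η).prod := by
  have hsp : A.charpoly = (A.charpoly.roots.map fun η => (X - C η)).prod :=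
    (IsAlgClosed.splits A.charpoly).eq_prod_roots_of_monic A.charpoly_monic
  induction s using Multiset.induction_on with
  | empty => simp
  | cons r s ih =>
    simp only [Multiset.map_cons, Multiset.prod_cons, map_mul, Matrix.det_mul, ih, eval_mul,
      Multiset.prod_map_mul]
    congr 1
    have h1 : (A.charpoly).eval r = (A.charpoly.roots.map fun η => (r - η)).prod := by
      conv_lhs => rw [hsp]
      rw [eval_multiset_prod, Multiset.map_map]
      simp
    have hc : Multiset.card A.charpoly.roots = Fintype.card n := by
      rw [← A.charpoly_natDegree_eq_dim]
      exact (IsAlgClosed.splits A.charpoly).natDegree_eq_card_roots.symm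
    rw [Matrix.eval_charpoly] at h1
    have h2 : aeval A (X - C r) = -(Matrix.scalar n r - A) := by
      simp [Matrix.algebraMap_eq_diagonal]
    rw [h2, Matrix.det_neg, h1, ← hc]
    have : (fun η : ℂ => eval η (X - C r)) = fun η => (-1) * (r - η) := by
      funext η; simp
    rw [this, Multiset.prod_map_mul]
    simp

theorem aux_charpoly_pow {n : Type*} [Fintype n] [DecidableEq n] (A : Matrix n n ℂ) (k : ℕ)
    (hk : 0 < k) :
    (A ^ k).charpoly = (A.charpoly.roots.map fun η => (X - C (η ^ k))).prod := by
  apply Polynomial.funext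
  intro c
  have hm : (X ^ k - C c : ℂ[X]).Monic := monic_X_pow_sub_C c hk.ne'
  have hp : (X ^ k - C c : ℂ[X]) = (((X ^ k - C c : ℂ[X]).roots).map fun r => (X - C r)).prod :=
    (IsAlgClosed.splits _).eq_prod_roots_of_monic hm
  have h := aux_det_prod A (X ^ k - C c : ℂ[X]).roots
  rw [← hp] at h
  have hc : Multiset.card A.charpoly.roots = Fintype.card n := by
    rw [← A.charpoly_natDegree_eq_dim]
    exact (IsAlgClosed.splits A.charpoly).natDegree_eq_card_roots.symm
  have h2 : aeval A (X ^ k - C c) = -(Matrix.scalar n c - A ^ k) := by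
    simp [Matrix.algebraMap_eq_diagonal]
  rw [h2, Matrix.det_neg] at h
  rw [Matrix.eval_charpoly, eval_multiset_prod, Multiset.map_map]
  have : (fun η : ℂ => eval η (X ^ k - C c)) = fun η => (-1) * (c - η ^ k) := by
    funext η; simp
  rw [this, Multiset.prod_map_mul] at h
  simp only [Multiset.map_const', Multiset.prod_replicate, hc] at h
  have h3 := mul_left_cancel₀ (by simp) h
  rw [h3]
  simp

theorem aux_trace_pow {n : Type*} [Fintype n] [DecidableEq n] (A : Matrix n n ℂ) (k : ℕ)
    (hk : 0 < k) :
    (A ^ k).trace = (A.charpoly.roots.map fun η => η ^ k).sum := by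
  rw [Matrix.trace_eq_sum_roots_charpoly, aux_charpoly_pow A k hk]
  congr 1
  rw [← Polynomial.roots_multiset_prod_X_sub_C (A.charpoly.roots.map fun η => η ^ k),
    Multiset.map_map]
  rfl

theorem aux_pow_apply {n : Type*} [Fintype n] [DecidableEq n] (A : Matrix n n ℂ) (m : ℕ) :
    ∀ i j, (A ^ (m + 1)) i j = ∑ u : Fin m → n,
      ∏ t : Fin (m + 1), A ((Fin.cons i u : Fin (m + 1) → n) t)
        ((Fin.snoc u j : Fin (m + 1) → n) t) := by
  induction m with
  | zero => intro i j; simp [Fin.snoc]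
  | succ m ih =>
    intro i j
    rw [pow_succ', Matrix.mul_apply,
      ← (Fin.consEquiv (fun _ : Fin (m + 1) => n)).sum_comp, Fintype.sum_prod_type]
    refine Finset.sum_congr rfl fun l _ => ?_
    rw [ih, Finset.mul_sum]
    refine Finset.sum_congr rfl fun u _ => ?_
    conv_rhs => rw [Fin.prod_univ_succ]
    simp only [Fin.consEquiv, Equiv.coe_fn_mk, ← Fin.cons_snoc_eq_snoc_cons, Fin.cons_zero,
      Fin.cons_succ]

theorem aux_trace_sum {n : Type*} [Fintype n] [DecidableEq n] (A : Matrix n n ℂ) (m : ℕ) :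
    (A ^ (m + 1)).trace = ∑ w : Fin (m + 1) → n, ∏ t : Fin (m + 1), A (w t) (w (t + 1)) := by
  rw [← (Fin.consEquiv (fun _ : Fin (m + 1) => n)).sum_comp, Fintype.sum_prod_type]
  refine Finset.sum_congr rfl fun i _ => ?_
  rw [Matrix.diag_apply, aux_pow_apply]
  refine Finset.sum_congr rfl fun u _ => ?_
  refine Finset.prod_congr rfl fun t _ => ?_
  simp only [Fin.consEquiv, Equiv.coe_fn_mk]
  congr 1
  induction t using Fin.lastCases with
  | last => simp
  | cast s => simp

end Algebra

section Walks

theorem aux_walk {V : Type*} {G : SimpleGraph V} (u : ℕ → V) (h : ∀ i, G.Adj (u i) (u (i + 1)))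
    (a n : ℕ) : ∃ p : G.Walk (u a) (u (a + n)), p.length = n ∧
      p.support = (List.range (n + 1)).map (fun i => u (a + i)) ∧
      p.edges = (List.range n).map (fun i => s(u (a + i), u (a + i + 1))) := by
  induction n with
  | zero => exact ⟨Walk.nil, by simp⟩
  | succ n ih =>
    obtain ⟨p, h1, h2, h3⟩ := ih
    refine ⟨p.concat (h (a + n)), by simp [h1], ?_, ?_⟩
    · rw [Walk.support_concat, h2, List.range_succ (n := n + 1)]
      simp
    · rw [Walk.edges_concat, h3, List.range_succ (n := n)]
      simp [add_assoc]

theorem aux_cycle {V : Type*} {G : SimpleGraph V} (u : ℕ → V) (h : ∀ i, G.Adj (u i) (u (i + 1)))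
    (d : ℕ) (hd : 3 ≤ d) (h0 : u d = u 0) (hinj : ∀ i < d, ∀ j < d, u i = u j → i = j) :
    ∃ p : G.Walk (u 0) (u 0), p.IsCycle ∧ p.length = d ∧
      ∀ e, e ∈ p.edges ↔ ∃ i < d, s(u i, u (i + 1)) = e := by
  obtain ⟨n, rfl⟩ : ∃ n, d = n + 1 := ⟨d - 1, by omega⟩
  obtain ⟨p, h1, h2, h3⟩ := aux_walk u h 1 n
  have he : u (1 + n) = u 0 := by rw [add_comm, h0]
  refine ⟨Walk.cons (h 0) (p.copy rfl he), ?_, by simp [h1], ?_⟩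
  · rw [Walk.cons_isCycle_iff]
    constructor
    · rw [Walk.isPath_def, Walk.support_copy, h2]
      refine List.Nodup.map_on ?_ List.nodup_range
      intro x hx y hy hxy
      simp only [List.mem_range] at hx hy
      by_cases hxn : x = n <;> by_cases hyn : y = n
      · omega
      · subst hxn
        rw [he] at hxy
        have := hinj 0 (by omega) _ (by omega) hxy
        omega
      · subst hyn
        rw [he] at hxy
        have := hinj _ (by omega) 0 (by omega) hxy
        omega
      · have := hinj _ (by omega) _ (by omega) hxy
        omega
    · rw [Walk.edges_copy, h3]
      intro hmem
      simp only [List.mem_map, List.mem_range, Sym2.eq_iff] at hmem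
      obtain ⟨i, hi, ⟨ha, hb⟩ | ⟨ha, hb⟩⟩ := hmem
      · have := hinj _ (by omega) _ (by omega) ha
        omega
      · have := hinj _ (by omega) _ (by omega) ha
        have hi0 : i = 0 := by omega
        subst hi0
        have := hinj _ (by omega) _ (by omega) hb
        omega
  · intro e
    rw [Walk.edges_cons, Walk.edges_copy, h3]
    simp only [List.mem_cons, List.mem_map, List.mem_range]
    constructor
    · rintro (rfl | ⟨i, hi, rfl⟩)
      · exact ⟨0, by omega, rfl⟩
      · exact ⟨1 + i, by omega, rfl⟩
    · rintro ⟨i, hi, rfl⟩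
      rcases i with _ | i
      · exact Or.inl rfl
      · exact Or.inr ⟨i, by omega, by rw [add_comm 1 i]⟩

theorem aux_girth {V : Type*} {G : SimpleGraph V} (d : ℕ) : ∀ (u : ℕ → V)
    (_ : ∀ i, G.Adj (u i) (u (i + 1))) (_ : ∀ i, u i ≠ u (i + 2))
    (_ : 0 < d) (_ : u d = u 0), G.girth ≤ d := by
  induction d using Nat.strong_induction_on with
  | _ d ih =>
    intro u h hb hd h0
    by_cases hinj : ∀ i < d, ∀ j < d, u i = u j → i = j
    · have hd3 : 3 ≤ d := by
        by_contra hlt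
        have : d = 1 ∨ d = 2 := by omega
        rcases this with rfl | rfl
        · exact (h 0).ne h0.symm
        · exact hb 0 h0.symm
      obtain ⟨p, hp, hl, -⟩ := aux_cycle u h d hd3 h0 hinj
      rw [← hl]
      exact girth_le_length hp
    · have key : ∃ i j, i < j ∧ j < d ∧ u j = u i := by
        push Not at hinj
        obtain ⟨i, hi, j, hj, hij, hne⟩ := hinj
        rcases lt_or_gt_of_ne hne with hlt | hlt
        · exact ⟨i, j, hlt, hj, hij.symm⟩
        · exact ⟨j, i, hlt, hi, hij⟩
      obtain ⟨i, j, hij, hj, he⟩ := key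
      have := ih (j - i) (by omega) (fun t => u (i + t)) (fun t => h _) (fun t => hb _) (by omega)
        (by simpa [show i + (j - i) = j by omega] using he)
      omega

end Walks

section Count

/-- Injective closed vertex sequences of length `k` along edges. -/
def CycSeq {V : Type*} (G : SimpleGraph V) (k : ℕ) : Type _ :=
  {u : ZMod k → V // Function.Injective u ∧ ∀ i, G.Adj (u i) (u (i + 1))}

theorem aux_inj {V : Type*} {G : SimpleGraph V} {k : ℕ} [NeZero k] (hk : k < 2 * G.girth)
    (u : ZMod k → V) (h : ∀ i, G.Adj (u i) (u (i + 1))) (hb : ∀ i, u i ≠ u (i + 2)) :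
    Function.Injective u := by
  have key : ∀ a b : ℕ, a < b → u (a : ZMod k) = u (b : ZMod k) → G.girth ≤ b - a := by
    intro a b hab he
    refine aux_girth (b - a) (fun t => u ((a + t : ℕ) : ZMod k)) (fun t => ?_) (fun t => ?_)
      (by omega) ?_
    · have := h ((a + t : ℕ) : ZMod k)
      simpa [add_assoc] using this
    · have := hb ((a + t : ℕ) : ZMod k)
      simpa [add_assoc] using this
    · simp only [show a + (b - a) = b by omega, add_zero]
      exact he.symm
  have key2 : ∀ x y : ZMod k, x.val < y.val → u x ≠ u y := by
    intro x y hlt he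
    have hy := ZMod.val_lt y
    have h1 := key x.val y.val hlt (by simpa using he)
    have h2 := key y.val (x.val + k) (by omega) (by simpa using he.symm)
    omega
  intro x y he
  by_contra hne
  have : x.val ≠ y.val := fun h' => hne (ZMod.val_injective k h')
  rcases lt_or_gt_of_ne this with hlt | hlt
  · exact key2 x y hlt he
  · exact key2 y x hlt he.symm

theorem aux_two_ne {k : ℕ} (hk : 3 ≤ k) : (2 : ZMod k) ≠ 0 := by
  intro h
  have h' : ((2 : ℕ) : ZMod k) = 0 := by exact_mod_cast h
  rw [ZMod.natCast_eq_zero_iff] at h'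
  have := Nat.le_of_dvd (by norm_num) h'
  omega

theorem aux_one_ne {k : ℕ} (hk : 3 ≤ k) : (1 : ZMod k) ≠ -1 := by
  intro h
  apply aux_two_ne hk
  linear_combination h

/-- Closed non-backtracking dart sequences are the same as cyclic vertex sequences. -/
noncomputable def aux_equiv {V : Type*} {G : SimpleGraph V} {k : ℕ} [NeZero k]
    (hk : k < 2 * G.girth) (hk3 : 3 ≤ k) :
    {w : ZMod k → G.Dart // ∀ t, (w t).snd = (w (t + 1)).fst ∧ w (t + 1) ≠ (w t).symm} ≃
      CycSeq G k where
  toFun w := ⟨fun t => (w.1 t).fst, by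
    have hadj : ∀ i, G.Adj (w.1 i).fst (w.1 (i + 1)).fst := by
      intro i
      rw [← (w.2 i).1]
      exact (w.1 i).adj
    refine ⟨aux_inj hk _ hadj ?_, hadj⟩
    intro i he
    apply (w.2 i).2
    apply SimpleGraph.Dart.ext
    apply Prod.ext
    · exact (w.2 i).1.symm
    · have h1 := (w.2 (i + 1)).1
      rw [add_assoc, one_add_one_eq_two] at h1
      exact h1.trans he.symm⟩
  invFun u := ⟨fun t => ⟨(u.1 t, u.1 (t + 1)), u.2.2 t⟩, by
    intro t
    refine ⟨rfl, fun he => ?_⟩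
    have h1 := congrArg (fun d : G.Dart => d.snd) he
    have h2 : u.1 (t + 1 + 1) = u.1 t := h1
    have h3 := u.2.1 h2
    apply aux_two_ne hk3
    linear_combination h3⟩
  left_inv w := by
    apply Subtype.ext
    funext t
    apply SimpleGraph.Dart.ext
    apply Prod.ext
    · rfl
    · exact (w.2 t).1.symm
  right_inv u := rfl

theorem aux_trace_card {V : Type*} [Fintype V] [DecidableEq V] (G : SimpleGraph V)
    [DecidableRel G.Adj] {k : ℕ}
    (hk : k < 2 * G.girth) (hk3 : 3 ≤ k) :
    (edgeMatrix G ℂ ^ k).trace = (Nat.card (CycSeq G k) : ℂ) := by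
  have : NeZero k := ⟨by omega⟩
  rw [← Nat.card_congr (aux_equiv hk hk3)]
  obtain ⟨m, rfl⟩ : ∃ m, k = m + 1 := ⟨k - 1, by omega⟩
  rw [aux_trace_sum]
  simp only [edgeMatrix, Finset.prod_boole, Finset.mem_univ, true_implies, Finset.sum_boole]
  rw [← Fintype.card_subtype, ← Nat.card_eq_fintype_card]
  rfl

/-- The edge set of a cyclic sequence. -/
def edgeSetOf {V : Type*} [DecidableEq V] {k : ℕ} [NeZero k] (u : ZMod k → V) :
    Finset (Sym2 V) := Finset.univ.image fun i => s(u i, u (i + 1))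

theorem aux_range {V : Type*} [DecidableEq V] (G : SimpleGraph V) {k : ℕ} [NeZero k] (hk3 : 3 ≤ k)
    (s : Finset (Sym2 V)) :
    (∃ (v : V) (p : G.Walk v v), p.IsCycle ∧ p.length = k ∧ p.edges.toFinset = s) ↔
      ∃ u : CycSeq G k, edgeSetOf u.1 = s := by
  constructor
  · rintro ⟨v, p, hp, rfl, rfl⟩
    have hw : ∀ n ≤ p.length, p.getVert ((n : ZMod p.length).val) = p.getVert n := by
      intro n hn
      rw [ZMod.val_natCast]
      rcases hn.lt_or_eq with h | rfl
      · rw [Nat.mod_eq_of_lt h]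
      · simp
    have hw1 : ∀ i : ZMod p.length, p.getVert ((i + 1).val) = p.getVert (i.val + 1) := by
      intro i
      rw [← hw (i.val + 1) (ZMod.val_lt i)]
      simp
    refine ⟨⟨fun i => p.getVert i.val, ?_, ?_⟩, ?_⟩
    · intro x y hxy
      have hx := ZMod.val_lt x
      have hy := ZMod.val_lt y
      apply ZMod.val_injective
      exact hp.getVert_injOn' (by simp only [Set.mem_ofPred_eq]; omega)
        (by simp only [Set.mem_ofPred_eq]; omega) hxy
    · intro i
      simp only [hw1]
      exact p.adj_getVert_succ (ZMod.val_lt i)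
    · ext e
      induction e using Sym2.ind with
      | _ x y =>
      rw [List.mem_toFinset, Walk.mk_mem_edges_iff_exists]
      simp only [edgeSetOf, Finset.mem_image, Finset.mem_univ, true_and, hw1]
      constructor
      · rintro ⟨i, hi⟩
        exact ⟨i.val, ZMod.val_lt i, hi⟩
      · rintro ⟨i, hi, he⟩
        refine ⟨(i : ZMod p.length), ?_⟩
        rw [ZMod.val_natCast, Nat.mod_eq_of_lt hi, he]
  · rintro ⟨u, rfl⟩
    obtain ⟨p, hp, hl, he⟩ := aux_cycle (fun n : ℕ => u.1 (n : ZMod k))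
      (fun i => by simpa using u.2.2 i) k hk3 (by simp) (by
        intro i hi j hj hij
        have := u.2.1 hij
        rw [ZMod.natCast_eq_natCast_iff'] at this
        rwa [Nat.mod_eq_of_lt hi, Nat.mod_eq_of_lt hj] at this)
    refine ⟨_, p, hp, hl, ?_⟩
    ext e
    rw [List.mem_toFinset, he]
    simp only [edgeSetOf, Finset.mem_image, Finset.mem_univ, true_and]
    constructor
    · rintro ⟨i, hi, rfl⟩
      exact ⟨i, by simp⟩
    · rintro ⟨i, rfl⟩
      exact ⟨i.val, ZMod.val_lt i, by simp⟩

/-- Rotation / reflection of a cyclic sequence. -/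
def rotSeq {V : Type*} {G : SimpleGraph V} {k : ℕ} (u : CycSeq G k) (c : ZMod k) (b : Bool) :
    CycSeq G k :=
  ⟨fun i => u.1 (if b then c + i else c - i), by
    constructor
    · intro x y hxy
      have := u.2.1 hxy
      cases b <;> simpa using this
    · intro i
      cases b
      · have := (u.2.2 (c - (i + 1))).symm
        simpa [show c - (i + 1) + 1 = c - i by ring] using this
      · have := (u.2.2 (c + i))
        simpa [add_assoc] using this⟩

theorem edgeSet_rot {V : Type*} [DecidableEq V] {G : SimpleGraph V} {k : ℕ} [NeZero k]
    (u : CycSeq G k) (c : ZMod k) (b : Bool) :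
    edgeSetOf (rotSeq u c b).1 = edgeSetOf u.1 := by
  ext e
  simp only [edgeSetOf, Finset.mem_image, Finset.mem_univ, true_and, rotSeq]
  cases b
  · constructor
    · rintro ⟨i, rfl⟩
      refine ⟨c - (i + 1), ?_⟩
      simp [show c - (i + 1) + 1 = c - i by ring, Sym2.eq_swap]
    · rintro ⟨i, rfl⟩
      refine ⟨c - (i + 1), ?_⟩
      simp only [Bool.false_eq_true, if_false]
      rw [show c - (c - (i + 1)) = i + 1 by ring, show c - (c - (i + 1) + 1) = i by ring,
        Sym2.eq_swap]
  · constructor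
    · rintro ⟨i, rfl⟩
      exact ⟨c + i, by simp [add_assoc]⟩
    · rintro ⟨i, rfl⟩
      refine ⟨i - c, ?_⟩
      simp only [if_true]
      rw [show c + (i - c) = i by ring, show c + (i - c + 1) = i + 1 by ring]

theorem aux_nbr {V : Type*} [DecidableEq V] {G : SimpleGraph V} {k : ℕ} [NeZero k]
    (u w : CycSeq G k) (h : edgeSetOf w.1 = edgeSetOf u.1) (i j : ZMod k)
    (hij : w.1 i = u.1 j) : w.1 (i + 1) = u.1 (j + 1) ∨ w.1 (i + 1) = u.1 (j - 1) := by
  have hm : s(w.1 i, w.1 (i + 1)) ∈ edgeSetOf u.1 := by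
    rw [← h]
    exact Finset.mem_image_of_mem _ (Finset.mem_univ i)
  simp only [edgeSetOf, Finset.mem_image, Finset.mem_univ, true_and, Sym2.eq_iff] at hm
  obtain ⟨l, ⟨h1, h2⟩ | ⟨h1, h2⟩⟩ := hm
  · left
    rw [hij] at h1
    rw [← h2, u.2.1 h1]
  · right
    rw [hij] at h2
    rw [← h1, ← u.2.1 h2, add_sub_cancel_right]

theorem aux_fiber {V : Type*} [DecidableEq V] {G : SimpleGraph V} {k : ℕ} [NeZero k]
    (hk3 : 3 ≤ k) (u w : CycSeq G k) (h : edgeSetOf w.1 = edgeSetOf u.1) :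
    ∃ c b, rotSeq u c b = w := by
  have h0 : ∃ c, w.1 0 = u.1 c := by
    have hm : s(w.1 0, w.1 (0 + 1)) ∈ edgeSetOf u.1 := by
      rw [← h]
      exact Finset.mem_image_of_mem (fun i => s(w.1 i, w.1 (i + 1))) (Finset.mem_univ 0)
    simp only [edgeSetOf, Finset.mem_image, Finset.mem_univ, true_and, Sym2.eq_iff] at hm
    obtain ⟨l, ⟨h1, h2⟩ | ⟨h1, h2⟩⟩ := hm
    · exact ⟨_, h1.symm⟩
    · exact ⟨_, h2.symm⟩
  obtain ⟨c, hc⟩ := h0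
  -- the sequence is determined by its first two values
  have key : ∀ v : CycSeq G k, edgeSetOf w.1 = edgeSetOf v.1 → w.1 0 = v.1 0 →
      w.1 1 = v.1 1 → v = w := by
    intro v hv e0 e1
    have hn : ∀ n : ℕ, w.1 (n : ZMod k) = v.1 (n : ZMod k) ∧
        w.1 ((n : ZMod k) + 1) = v.1 ((n : ZMod k) + 1) := by
      intro n
      induction n with
      | zero => simpa using ⟨e0, e1⟩
      | succ n ih =>
        refine ⟨by simpa using ih.2, ?_⟩
        rcases aux_nbr v w hv _ _ ih.2 with h' | h'
        · simpa using h'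
        · exfalso
          rw [add_sub_cancel_right, ← ih.1] at h'
          have := w.2.1 h'
          apply aux_two_ne hk3
          linear_combination this
    apply Subtype.ext
    funext i
    have := (hn i.val).1
    simpa using this.symm
  have h1 := aux_nbr u w h 0 c hc
  rw [zero_add] at h1
  rcases h1 with h1 | h1
  · refine ⟨c, true, key _ (by rw [edgeSet_rot, h]) ?_ ?_⟩
    · simpa [rotSeq] using hc
    · simpa [rotSeq] using h1
  · refine ⟨c, false, key _ (by rw [edgeSet_rot, h]) ?_ ?_⟩
    · simpa [rotSeq] using hc
    · simpa [rotSeq] using h1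

theorem aux_card {V : Type*} [Fintype V] [DecidableEq V] (G : SimpleGraph V) {k : ℕ}
    (hk3 : 3 ≤ k) : Nat.card (CycSeq G k) = cycleCount G k * (k * 2) := by
  have : NeZero k := ⟨by omega⟩
  have hS : cycleCount G k = Nat.card {s : Finset (Sym2 V) // ∃ u : CycSeq G k, edgeSetOf u.1 = s} :=
    Nat.card_congr (Equiv.subtypeEquivRight fun s => aux_range G hk3 s)
  rw [hS]
  let S := {s : Finset (Sym2 V) // ∃ u : CycSeq G k, edgeSetOf u.1 = s}
  let rep : S → CycSeq G k := fun s => s.2.choose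
  have hrep : ∀ s : S, edgeSetOf (rep s).1 = s.1 := fun s => s.2.choose_spec
  let F : S × (ZMod k × Bool) → CycSeq G k := fun x => rotSeq (rep x.1) x.2.1 x.2.2
  have hF : Function.Bijective F := by
    constructor
    · rintro ⟨s, c, b⟩ ⟨s', c', b'⟩ he
      have h1 : s = s' := by
        apply Subtype.ext
        have := congrArg (fun u : CycSeq G k => edgeSetOf u.1) he
        simpa only [F, edgeSet_rot, hrep] using this
      subst h1
      have hval : ∀ i : ZMod k, (if b then c + i else c - i) = (if b' then c' + i else c' - i) := by
        intro i
        have : (F (s, c, b)).1 i = (F (s, c', b')).1 i := by rw [he]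
        exact (rep s).2.1 this
      have h0 : c = c' := by
        have := hval 0
        simpa using this
      subst h0
      have h1 := hval 1
      have hb : b = b' := by
        cases b <;> cases b'
        · rfl
        · exfalso
          simp only [Bool.false_eq_true, if_false, if_true] at h1
          exact aux_one_ne hk3 (by linear_combination -h1)
        · exfalso
          simp only [Bool.false_eq_true, if_false, if_true] at h1
          exact aux_one_ne hk3 (by linear_combination h1)
        · rfl
      rw [hb]
    · intro w
      obtain ⟨c, b, hcb⟩ := aux_fiber hk3 (rep ⟨edgeSetOf w.1, w, rfl⟩) w
        (hrep ⟨edgeSetOf w.1, w, rfl⟩).symm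
      exact ⟨(⟨edgeSetOf w.1, w, rfl⟩, c, b), hcb⟩
  rw [← Nat.card_congr (Equiv.ofBijective F hF), Nat.card_prod, Nat.card_prod, Nat.card_zmod]
  simp [S]

end Count

/-- If `G` has girth `g` and `{η_i}` is the eigenvalue multiset of the directed edge
matrix, then for `g ≤ k < 2g` the number of `k`-cycles equals `(Σ_i η_i^k)/(2k)`. -/
theorem cycleCount_eq_sum_eigenvalues_pow (G : SimpleGraph V) [DecidableRel G.Adj]
    (g k : ℕ) (hg : G.girth = g) (hg3 : 3 ≤ g) (hgk : g ≤ k) (hk2g : k < 2 * g) :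
    (cycleCount G k : ℂ) =
      (((edgeMatrix G ℂ).charpoly.roots).map (fun η => η ^ k)).sum / (2 * k) := by
  have hk3 : 3 ≤ k := hg3.trans hgk
  have hk0 : (k : ℂ) ≠ 0 := by
    exact_mod_cast (show k ≠ 0 by omega)
  rw [← aux_trace_pow _ k (by omega), aux_trace_card G (by omega) hk3, aux_card G hk3]
  push_cast
  field_simp
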